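/- arXiv:1711.01700 — 9 statements merged into one kernel-verified Lean document; each statement's English description precedes it below -/
import Mathlib

section
/- There exists a constant C > 0 such that for every finite directed graph G = (V,E) with n = |V| ≥ 2 vertices, there exists a set S of shortcuts (ordered pairs (u,v) of vertices with u ⪯_G v) satisfying: (1) |S| ≤ C·n·(log n)², and (2) for every pair of vertices u,v with u ⪯_G v, there is a directed path from u to v in the augmented graph (V, E ∪ S) consisting of at most C·n^{2/3}·(log n)^{4/3} arcs. -/
/-- `ReachLen E k u v`: there is a directed path from `u` to `v` in the digraph with
arc relation `E` consisting of exactly `k` arcs. -/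
def ReachLen {V : Type*} (E : V → V → Prop) : ℕ → V → V → Prop
  | 0, u, v => u = v
  | n + 1, u, v => ∃ w, E u w ∧ ReachLen E n w v

/-- `Reaches E u v` (`u ⪯ v`): there is a (possibly empty) directed path from `u` to `v`. -/
def Reaches {V : Type*} (E : V → V → Prop) (u v : V) : Prop :=
  ∃ k, ReachLen E k u v

theorem ReachLen.mono {V : Type*} {E E' : V → V → Prop} (h : ∀ a b, E a b → E' a b) :
    ∀ {k : ℕ} {u v : V}, ReachLen E k u v → ReachLen E' k u v
  | 0, _, _, huv => huv
  | _ + 1, _, _, ⟨w, huw, hwv⟩ => ⟨w, h _ _ huw, hwv.mono h⟩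

theorem ReachLen.trans {V : Type*} {E : V → V → Prop} :
    ∀ {a b : ℕ} {u v w : V}, ReachLen E a u v → ReachLen E b v w → ReachLen E (a + b) u w
  | 0, b, u, v, w, huv, hvw => by
    obtain rfl : u = v := huv
    simpa using hvw
  | a + 1, b, u, v, w, ⟨x, hux, hxv⟩, hvw => by
    rw [Nat.add_right_comm]
    exact ⟨x, hux, hxv.trans hvw⟩

theorem ReachLen.exists_split {V : Type*} {E : V → V → Prop} :
    ∀ {a b : ℕ} {u w : V}, ReachLen E (a + b) u w → ∃ v, ReachLen E a u v ∧ ReachLen E b v w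
  | 0, b, u, w, h => ⟨u, rfl, by simpa using h⟩
  | a + 1, b, u, w, h => by
    rw [Nat.add_right_comm] at h
    obtain ⟨x, hux, hxw⟩ := h
    obtain ⟨v, hxv, hvw⟩ := hxw.exists_split
    exact ⟨v, ⟨x, hux, hxv⟩, hvw⟩

/-- `IsDist E k u v`: the shortest directed path from `u` to `v` has exactly `k` arcs. -/
def IsDist {V : Type*} (E : V → V → Prop) (k : ℕ) (u v : V) : Prop :=
  ReachLen E k u v ∧ ∀ j, ReachLen E j u v → k ≤ j

theorem Reaches.exists_isDist {V : Type*} {E : V → V → Prop} {u v : V} (h : Reaches E u v) :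
    ∃ k, IsDist E k u v := by
  classical
  exact ⟨Nat.find h, Nat.find_spec h, fun _ hj => Nat.find_min' h hj⟩

/-- A shortest path splits into shortest paths. -/
theorem IsDist.exists_split {V : Type*} {E : V → V → Prop} {a b : ℕ} {u w : V}
    (h : IsDist E (a + b) u w) : ∃ v, IsDist E a u v ∧ IsDist E b v w := by
  obtain ⟨v, huv, hvw⟩ := h.1.exists_split
  refine ⟨v, ⟨huv, fun j hj => ?_⟩, ⟨hvw, fun j hj => ?_⟩⟩
  · have := h.2 _ (hj.trans hvw)
    omega
  · have := h.2 _ (huv.trans hj)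
    omega

open Classical in
/-- The vertices lying on some directed path from `u` to `v` with exactly `k` arcs. -/
noncomputable def pathVertices {V : Type*} [Fintype V] (E : V → V → Prop) (k : ℕ) (u v : V) :
    Finset V :=
  {w | ∃ i ≤ k, ReachLen E i u w ∧ ReachLen E (k - i) w v}

theorem IsDist.le_card_pathVertices {V : Type*} [Fintype V] {E : V → V → Prop} {k : ℕ} {u v : V}
    (h : IsDist E k u v) : k ≤ (pathVertices E k u v).card := by
  have hsplit : ∀ i : Fin k, ∃ w, ReachLen E i u w ∧ ReachLen E (k - i) w v := fun i =>
    ReachLen.exists_split (by rw [Nat.add_sub_cancel' i.2.le]; exact h.1)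
  choose f hf hf' using hsplit
  have hinj : Function.Injective f := by
    intro i j hij
    have h₁ := h.2 _ ((hf i).trans (hij ▸ hf' j))
    have h₂ := h.2 _ ((hf j).trans (hij ▸ hf' i))
    ext
    omega
  calc k = (Finset.univ.map ⟨f, hinj⟩).card := by simp
    _ ≤ _ := Finset.card_le_card fun w hw => by
      obtain ⟨i, -, rfl⟩ := Finset.mem_map.1 hw
      simp only [pathVertices, Finset.mem_filter, Finset.mem_univ, true_and]
      exact ⟨i, i.2.le, hf i, hf' i⟩

/-- Greedy hitting: `k` points can be chosen so that the number of sets that they miss drops by a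
factor of `(1 - m / n) ^ k`, if each set has at least `m` of the `n` available points. -/
theorem exists_card_filter_disjoint_le {ι V : Type*} [Fintype V] [DecidableEq V] [Nonempty V]
    (F : Finset ι) (A : ι → Finset V) (m : ℕ) (hA : ∀ i ∈ F, m ≤ (A i).card) (k : ℕ) :
    ∃ H : Finset V, H.card ≤ k ∧
      ((F.filter fun i => Disjoint (A i) H).card : ℝ) ≤
        F.card * (1 - (m : ℝ) / Fintype.card V) ^ k := by
  rcases F.eq_empty_or_nonempty with rfl | ⟨i₀, hi₀⟩
  · exact ⟨∅, by simp⟩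
  have hn : (0 : ℝ) < Fintype.card V := by exact_mod_cast Fintype.card_pos
  have hq : 0 ≤ 1 - (m : ℝ) / Fintype.card V := by
    rw [sub_nonneg, div_le_one hn]
    exact_mod_cast (hA _ hi₀).trans (Finset.card_le_univ _)
  induction k with
  | zero => exact ⟨∅, by simp⟩
  | succ k ih =>
    obtain ⟨H, hHk, hH⟩ := ih
    set G := F.filter fun i => Disjoint (A i) H with hG
    have hcount : ∑ x : V, ((G.filter fun i => x ∈ A i).card : ℝ) =
        ∑ i ∈ G, ((A i).card : ℝ) := by
      have := Finset.sum_card_bipartiteAbove_eq_sum_card_bipartiteBelow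
        (s := (Finset.univ : Finset V)) (t := G) (fun x i => x ∈ A i)
      simp only [Finset.bipartiteAbove, Finset.bipartiteBelow, Finset.filter_mem_eq_inter,
        Finset.univ_inter] at this
      exact_mod_cast this
    have hsum : ∑ _x : V, (G.card : ℝ) * ((m : ℝ) / Fintype.card V) ≤
        ∑ x : V, ((G.filter fun i => x ∈ A i).card : ℝ) := by
      rw [hcount, Finset.sum_const, Finset.card_univ, nsmul_eq_mul]
      calc _ = ∑ _i ∈ G, (m : ℝ) := by
            rw [Finset.sum_const, nsmul_eq_mul]
            field_simp
        _ ≤ _ := Finset.sum_le_sum fun i hi => by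
            exact_mod_cast hA i (Finset.mem_filter.1 hi).1
    obtain ⟨x, -, hx⟩ := Finset.exists_le_of_sum_le Finset.univ_nonempty hsum
    refine ⟨insert x H, (Finset.card_insert_le _ _).trans (by omega), ?_⟩
    have hfilter : (F.filter fun i => Disjoint (A i) (insert x H)) =
        G.filter fun i => ¬ x ∈ A i := by
      rw [hG, Finset.filter_filter]
      refine Finset.filter_congr fun i _ => ?_
      rw [Finset.disjoint_insert_right, and_comm]
    have hadd : ((G.filter fun i => x ∈ A i).card : ℝ) + (G.filter fun i => ¬ x ∈ A i).card =
        G.card := by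
      exact_mod_cast Finset.card_filter_add_card_filter_not (s := G) fun i => x ∈ A i
    rw [hfilter, pow_succ, ← mul_assoc]
    calc ((G.filter fun i => ¬ x ∈ A i).card : ℝ)
        ≤ G.card * (1 - (m : ℝ) / Fintype.card V) := by linarith
      _ ≤ _ := mul_le_mul_of_nonneg_right hH hq

/-- A small set of vertices meets the shortest paths between any two vertices at distance `L`. -/
theorem exists_hitting_set {V : Type*} [Fintype V] [DecidableEq V] (E : V → V → Prop)
    (hV : 2 ≤ Fintype.card V) (L : ℕ) (hL : √(Fintype.card V : ℝ) ≤ L) :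
    ∃ H : Finset V, (H.card : ℝ) ≤ 3 * √(Fintype.card V : ℝ) * Real.logb 2 (Fintype.card V) ∧
      ∀ u v, IsDist E L u v → ∃ w ∈ H, w ∈ pathVertices E L u v := by
  classical
  have : Nonempty V := Fintype.card_pos_iff.1 (by omega)
  set n : ℝ := (Fintype.card V : ℝ) with hn
  have hn2 : (2 : ℝ) ≤ n := by
    rw [hn]
    exact_mod_cast hV
  have hs1 : 1 ≤ √n := Real.one_le_sqrt.2 (by linarith)
  have hss : √n * √n = n := Real.mul_self_sqrt (by linarith)
  have hlog0 : 0 ≤ Real.log n := Real.log_nonneg (by linarith)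
  have hlogb1 : 1 ≤ Real.logb 2 n := by
    rw [Real.le_logb_iff_rpow_le (by norm_num) (by linarith)]
    simpa using hn2
  have hlog : Real.log n ≤ Real.logb 2 n := by
    rw [Real.logb, le_div_iff₀ (Real.log_pos (by norm_num))]
    exact mul_le_of_le_one_right hlog0 (by linarith [Real.log_two_lt_d9])
  set k := ⌊2 * √n * Real.log n⌋₊ + 1 with hk
  have hkle : (k : ℝ) ≤ 3 * √n * Real.logb 2 n := by
    have h₁ : (⌊2 * √n * Real.log n⌋₊ : ℝ) ≤ 2 * √n * Real.log n :=
      Nat.floor_le (by positivity)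
    have h₂ : 2 * √n * Real.log n ≤ 2 * √n * Real.logb 2 n := by gcongr
    have h₃ : 1 ≤ √n * Real.logb 2 n := one_le_mul_of_one_le_of_one_le hs1 hlogb1
    rw [hk]
    push_cast
    linarith
  have hklt : 2 * √n * Real.log n < k := by
    rw [hk]
    exact_mod_cast Nat.lt_floor_add_one (2 * √n * Real.log n)
  set F : Finset (V × V) := {p | IsDist E L p.1 p.2} with hF
  have hFA : ∀ p ∈ F, L ≤ (pathVertices E L p.1 p.2).card := fun p hp =>
    (Finset.mem_filter.1 hp).2.le_card_pathVertices
  obtain ⟨H, hHk, hH⟩ :=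
    exists_card_filter_disjoint_le F (fun p => pathVertices E L p.1 p.2) L hFA k
  refine ⟨H, le_trans (by exact_mod_cast hHk) hkle, fun u v huv => ?_⟩
  by_contra! hcon
  have huvF : (u, v) ∈ F := by simpa [hF] using huv
  have hmem : (u, v) ∈ F.filter fun p => Disjoint (pathVertices E L p.1 p.2) H := by
    rw [Finset.mem_filter]
    exact ⟨huvF, Finset.disjoint_right.2 hcon⟩
  have hone : (1 : ℝ) ≤ (F.filter fun p => Disjoint (pathVertices E L p.1 p.2) H).card := by
    exact_mod_cast Finset.card_pos.2 ⟨_, hmem⟩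
  have hFcard : (F.card : ℝ) ≤ n ^ 2 := by
    have := Finset.card_le_univ F
    rw [Fintype.card_prod, ← sq] at this
    rw [hn]
    exact_mod_cast this
  have hLn : (L : ℝ) ≤ n := by
    rw [hn]
    exact_mod_cast (hFA _ huvF).trans (Finset.card_le_univ _)
  have hq0 : 0 ≤ 1 - (L : ℝ) / n := by
    rw [sub_nonneg, div_le_one (by linarith)]
    exact hLn
  have hpow : (1 - (L : ℝ) / n) ^ k ≤ Real.exp (-((L : ℝ) / n)) ^ k :=
    pow_le_pow_left₀ hq0 (Real.one_sub_le_exp_neg _) k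
  have hexp : 2 * Real.log n < k * ((L : ℝ) / n) := by
    have h₁ : 1 / √n ≤ (L : ℝ) / n := by
      rw [div_le_div_iff₀ (by linarith) (by linarith), one_mul]
      nlinarith
    calc 2 * Real.log n = (2 * √n * Real.log n) * (1 / √n) := by field_simp
      _ < k * (1 / √n) := by gcongr
      _ ≤ _ := by gcongr
  have hlt : n ^ 2 * Real.exp (-((L : ℝ) / n)) ^ k < 1 := by
    have h₁ : n ^ 2 = Real.exp (2 * Real.log n) := by
      rw [two_mul, Real.exp_add, Real.exp_log (by linarith), sq]
    rw [h₁, ← Real.exp_nat_mul, ← Real.exp_add, Real.exp_lt_one_iff]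
    linarith
  have : (F.card : ℝ) * (1 - (L : ℝ) / n) ^ k ≤ n ^ 2 * Real.exp (-((L : ℝ) / n)) ^ k := by
    gcongr
  linarith

/-- There exists a constant `C > 0` such that every finite digraph on `n ≥ 2` vertices
admits a set `S` of at most `C·n·(log₂ n)²` shortcuts such that in the augmented graph
every related pair `u ⪯ v` is joined by a directed path of at most
`C·n^(2/3)·(log₂ n)^(4/3)` arcs. -/
theorem diameter_reduction_exists :
    ∃ C : ℝ, 0 < C ∧
      ∀ (V : Type) [Fintype V] [DecidableEq V] (E : V → V → Prop),
        2 ≤ Fintype.card V →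
        ∃ S : Finset (V × V),
          (∀ p ∈ S, Reaches E p.1 p.2) ∧
          (S.card : ℝ) ≤
            C * (Fintype.card V : ℝ) * (Real.logb 2 (Fintype.card V)) ^ 2 ∧
          (∀ u v : V, Reaches E u v →
            ∃ k : ℕ,
              (k : ℝ) ≤ C * (Fintype.card V : ℝ) ^ ((2 : ℝ) / 3) *
                (Real.logb 2 (Fintype.card V)) ^ ((4 : ℝ) / 3) ∧
              ReachLen (fun a b => E a b ∨ (a, b) ∈ S) k u v) := by
  classical
  refine ⟨9, by norm_num, fun V _ _ E hV => ?_⟩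
  set n : ℝ := (Fintype.card V : ℝ) with hn
  have hn2 : (2 : ℝ) ≤ n := by
    rw [hn]
    exact_mod_cast hV
  have hs1 : 1 ≤ √n := Real.one_le_sqrt.2 (by linarith)
  have hlogb1 : 1 ≤ Real.logb 2 n := by
    rw [Real.le_logb_iff_rpow_le (by norm_num) (by linarith)]
    simpa using hn2
  set L := ⌈√n⌉₊ with hL
  have hLlt : (L : ℝ) < √n + 1 := Nat.ceil_lt_add_one (by positivity)
  obtain ⟨H, hHcard, hH⟩ := exists_hitting_set E hV L (Nat.le_ceil _)
  have hdiam : ((2 * L + 1 : ℕ) : ℝ) ≤ 9 * n ^ ((2 : ℝ) / 3) * Real.logb 2 n ^ ((4 : ℝ) / 3) := by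
    have h₁ : √n ≤ n ^ ((2 : ℝ) / 3) := by
      rw [Real.sqrt_eq_rpow]
      exact Real.rpow_le_rpow_of_exponent_le (by linarith) (by norm_num)
    have h₂ : 1 ≤ Real.logb 2 n ^ ((4 : ℝ) / 3) := Real.one_le_rpow hlogb1 (by norm_num)
    calc ((2 * L + 1 : ℕ) : ℝ) ≤ 9 * n ^ ((2 : ℝ) / 3) := by
          push_cast
          linarith
      _ ≤ _ := le_mul_of_one_le_right (by positivity) h₂
  refine ⟨(H ×ˢ H).filter fun p => Reaches E p.1 p.2, fun p hp => (Finset.mem_filter.1 hp).2,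
    ?_, fun u v huv => ?_⟩
  · calc _ ≤ ((H ×ˢ H).card : ℝ) := by exact_mod_cast Finset.card_filter_le _ _
      _ = (H.card : ℝ) ^ 2 := by
        rw [Finset.card_product]
        push_cast
        ring
      _ ≤ (3 * √n * Real.logb 2 n) ^ 2 := by gcongr
      _ = _ := by
        rw [mul_pow, mul_pow, Real.sq_sqrt (by linarith)]
        norm_num
  · obtain ⟨D, hD⟩ := huv.exists_isDist
    by_cases hDL : D ≤ 2 * L
    · refine ⟨D, le_trans ?_ hdiam, hD.1.mono fun _ _ => Or.inl⟩
      exact_mod_cast hDL.trans (Nat.le_succ _)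
    · obtain ⟨d, rfl⟩ : ∃ d, D = L + (d + L) := ⟨D - 2 * L, by omega⟩
      obtain ⟨a, hua, hav⟩ := hD.exists_split
      obtain ⟨b, hab, hbv⟩ := hav.exists_split
      obtain ⟨x, hxH, hx⟩ := hH _ _ hua
      obtain ⟨y, hyH, hy⟩ := hH _ _ hbv
      simp only [pathVertices, Finset.mem_filter, Finset.mem_univ, true_and] at hx hy
      obtain ⟨i, hi, hux, hxa⟩ := hx
      obtain ⟨j, hj, hby, hyv⟩ := hy
      have hxy : Reaches E x y := ⟨_, (hxa.trans hab.1).trans hby⟩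
      refine ⟨i + (L - j + 1), le_trans ?_ hdiam,
        (hux.mono fun _ _ => Or.inl).trans ⟨y, Or.inr ?_, hyv.mono fun _ _ => Or.inl⟩⟩
      · exact_mod_cast (by omega : i + (L - j + 1) ≤ 2 * L + 1)
      · simp [hxH, hyH, hxy]
end

section
/- Let (Ω, 𝓕, μ) be a probability space equipped with a filtration (𝓕_r)_{r∈ℕ}, and let (Φ_r)_{r∈ℕ} be a sequence of nonnegative integrable real-valued random variables adapted to the filtration such that: Φ_0 is almost surely equal to a constant c ≥ 0; for every r ≥ 1, Φ_r ≤ Φ_{r−1} almost surely; and there is a real p with 0 < p < 1 such that for every r ≥ 1, the conditional expectation satisfies 𝔼[Φ_r | 𝓕_{r−1}] ≤ p·Φ_{r−1} almost surely. Then for all natural numbers k ≥ 0 and w ≥ 0, μ{ Φ_{k+w+2} > p^k · c } ≤ p^w. -/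
open MeasureTheory

/-- If a process shrinks by a factor `p` in conditional expectation at every step, then its
expectation decays at least as fast as `p ^ n`. -/
theorem integral_le_pow_mul_integral_of_condExp_le
    {Ω : Type*} {m0 : MeasurableSpace Ω} {μ : Measure Ω} [IsFiniteMeasure μ]
    {𝓕 : Filtration ℕ m0} {Φ : ℕ → Ω → ℝ} (hint : ∀ r, Integrable (Φ r) μ)
    {p : ℝ} (hp : 0 ≤ p) (hcond : ∀ r, μ[Φ (r + 1) | 𝓕 r] ≤ᵐ[μ] fun ω => p * Φ r ω) (n : ℕ) :
    ∫ ω, Φ n ω ∂μ ≤ p ^ n * ∫ ω, Φ 0 ω ∂μ := by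
  induction n with
  | zero => simp
  | succ n ih =>
    calc ∫ ω, Φ (n + 1) ω ∂μ = ∫ ω, (μ[Φ (n + 1) | 𝓕 n]) ω ∂μ :=
          (integral_condExp (𝓕.le n)).symm
      _ ≤ ∫ ω, p * Φ n ω ∂μ :=
          integral_mono_ae integrable_condExp ((hint n).const_mul p) (hcond n)
      _ = p * ∫ ω, Φ n ω ∂μ := integral_const_mul p _
      _ ≤ p * (p ^ n * ∫ ω, Φ 0 ω ∂μ) := mul_le_mul_of_nonneg_left ih hp
      _ = p ^ (n + 1) * ∫ ω, Φ 0 ω ∂μ := by ring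

/-- Karp's probabilistic recurrence theorem (special case, Theorem 2.1 of the paper):
if `(Φ_r)` is a nonincreasing sequence of nonnegative random variables adapted to a
filtration, starting a.s. at the constant `c`, and shrinking by a factor `p < 1` in
conditional expectation at every step, then
`μ{ Φ_{k+w+2} > p^k·c } ≤ p^w` for all `k, w ∈ ℕ`. -/
theorem karp_probabilistic_recurrence
    {Ω : Type*} {m0 : MeasurableSpace Ω} (μ : Measure Ω) [IsProbabilityMeasure μ]
    (𝓕 : Filtration ℕ m0) (Φ : ℕ → Ω → ℝ) (c : ℝ) (hc : 0 ≤ c)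
    (hadapted : Adapted 𝓕 Φ)
    (hnonneg : ∀ r, 0 ≤ᵐ[μ] Φ r)
    (hint : ∀ r, Integrable (Φ r) μ)
    (h0 : Φ 0 =ᵐ[μ] fun _ => c)
    (hmono : ∀ r, Φ (r + 1) ≤ᵐ[μ] Φ r)
    (p : ℝ) (hp0 : 0 < p) (hp1 : p < 1)
    (hcond : ∀ r, μ[Φ (r + 1) | 𝓕 r] ≤ᵐ[μ] fun ω => p * Φ r ω)
    (k w : ℕ) :
    μ {ω | p ^ k * c < Φ (k + w + 2) ω} ≤ ENNReal.ofReal (p ^ w) := by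
  have hp := hp0.le
  rcases hc.eq_or_lt with rfl | hc
  · have hle : ∀ r, ∀ᵐ ω ∂μ, Φ r ω ≤ 0 := by
      intro r
      induction r with
      | zero => exact h0.le
      | succ r ih => filter_upwards [ih, hmono r] with ω h1 h2 using h2.trans h1
    have hnull : μ {ω | p ^ k * 0 < Φ (k + w + 2) ω} = 0 := by
      simpa only [mul_zero, ae_iff, not_le] using hle (k + w + 2)
    rw [hnull]
    exact zero_le
  · have hpos : 0 < p ^ k * c := by positivity
    have hmarkov :=
      mul_meas_ge_le_integral_of_nonneg (hnonneg (k + w + 2)) (hint (k + w + 2)) (p ^ k * c)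
    have hdecay := integral_le_pow_mul_integral_of_condExp_le hint hp hcond (k + w + 2)
    have hinit : ∫ ω, Φ 0 ω ∂μ = c := by simp [integral_congr_ae h0]
    rw [hinit] at hdecay
    have hpow : p ^ (k + w + 2) * c ≤ p ^ k * c * p ^ w := by
      calc p ^ (k + w + 2) * c ≤ p ^ (k + w) * c := by
            gcongr ?_ * c
            exact pow_le_pow_of_le_one hp hp1.le (by omega)
        _ = p ^ k * c * p ^ w := by ring
    have hreal : μ.real {ω | p ^ k * c ≤ Φ (k + w + 2) ω} ≤ p ^ w :=
      le_of_mul_le_mul_left ((hmarkov.trans hdecay).trans hpow) hpos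
    calc μ {ω | p ^ k * c < Φ (k + w + 2) ω}
        ≤ μ {ω | p ^ k * c ≤ Φ (k + w + 2) ω} :=
          measure_mono (Set.ofPred_subset_ofPred.2 fun _ => le_of_lt)
      _ = ENNReal.ofReal (μ.real {ω | p ^ k * c ≤ Φ (k + w + 2) ω}) := (ofReal_measureReal).symm
      _ ≤ ENNReal.ofReal (p ^ w) := ENNReal.ofReal_le_ofReal hreal
end

section
/- Let G = (V,E) be a directed graph, let P = ⟨v_0, v_1, …, v_ℓ⟩ be a path in G, and let x be an ancestor of P (that is, x ⪯ v_i for some index i, and v_j ⋠ x for every index j). Let a be the least index with x ⪯ v_a. Then: for every index i < a, x and v_i are unrelated (x ⋠ v_i and v_i ⋠ x); and for every index i ≥ a, x ⪯ v_i and v_i ⋠ x. Consequently P splits as P = P₁ ⧺ P₂ where the prefix P₁ = ⟨v_0,…,v_{a−1}⟩ lies entirely in V_R = { w ∈ V : w and x are unrelated } and the suffix P₂ = ⟨v_a,…,v_ℓ⟩ lies entirely in V_S = { w ∈ V : x ⪯ w and w ⋠ x }. -/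
/-- `Reach E u v` (`u ⪯ v`): there is a (possibly empty) directed path from `u` to `v`
in the digraph with arc relation `E`. -/
def Reach {V : Type*} (E : V → V → Prop) : V → V → Prop :=
  Relation.ReflTransGen E

/-- Case 3 of the paper's Lemma 3.3: if `x` is an ancestor of a path
`P = ⟨v 0, …, v ℓ⟩` and `a` is the least index with `x ⪯ v a`, then every vertex
before index `a` is unrelated to `x` (so lies in `V_R`), and every vertex from
index `a` on satisfies `x ⪯ v i` and `v i ⋠ x` (so lies in `V_S`). -/
theorem path_split_ancestor {V : Type*} (E : V → V → Prop)
    (ℓ : ℕ) (v : ℕ → V) (hpath : ∀ i < ℓ, E (v i) (v (i + 1)))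
    (x : V)
    (hanc : (∃ i ≤ ℓ, Reach E x (v i)) ∧ ∀ j ≤ ℓ, ¬ Reach E (v j) x)
    (a : ℕ)
    (ha : a ≤ ℓ ∧ Reach E x (v a) ∧ ∀ i < a, ¬ Reach E x (v i)) :
    (∀ i < a, ¬ Reach E x (v i) ∧ ¬ Reach E (v i) x) ∧
    (∀ i, a ≤ i → i ≤ ℓ → Reach E x (v i) ∧ ¬ Reach E (v i) x) ∧
    (∀ i < a, v i ∈ {w : V | ¬ Reach E x w ∧ ¬ Reach E w x}) ∧
    (∀ i, a ≤ i → i ≤ ℓ → v i ∈ {w : V | Reach E x w ∧ ¬ Reach E w x}) := by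
  obtain ⟨-, hnot⟩ := hanc
  obtain ⟨haℓ, hxa, hmin⟩ := ha
  have hpre : ∀ i < a, ¬ Reach E x (v i) ∧ ¬ Reach E (v i) x := fun i hi =>
    ⟨hmin i hi, hnot i (hi.le.trans haℓ)⟩
  have hreach : ∀ i, a ≤ i → i ≤ ℓ → Reach E x (v i) := by
    intro i hai
    induction i, hai using Nat.le_induction with
    | base => exact fun _ => hxa
    | succ i _ ih =>
      exact fun hi => Relation.ReflTransGen.tail (ih (Nat.le_of_succ_le hi)) (hpath i hi)
  have hsuf : ∀ i, a ≤ i → i ≤ ℓ → Reach E x (v i) ∧ ¬ Reach E (v i) x := fun i hai hi =>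
    ⟨hreach i hai hi, hnot i hi⟩
  exact ⟨hpre, hsuf, hpre, hsuf⟩
end

section
/- Let G = (V,E) be a directed graph, let P = ⟨v_0, v_1, …, v_ℓ⟩ be a path in G, and let x be a descendent of P (that is, v_i ⪯ x for some index i, and x ⋠ v_j for every index j). Let k be the greatest index with v_k ⪯ x. Then: for every index i ≤ k, v_i ⪯ x and x ⋠ v_i; and for every index i > k, x and v_i are unrelated. Consequently P splits as P = P₁ ⧺ P₂ where the prefix P₁ = ⟨v_0,…,v_k⟩ lies entirely in V_P = { w ∈ V : w ⪯ x and x ⋠ w } and the suffix P₂ = ⟨v_{k+1},…,v_ℓ⟩ lies entirely in V_R = { w ∈ V : w and x are unrelated }. -/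
/-- Along a path, earlier vertices reach later ones. -/
theorem reach_of_path {V : Type*} {E : V → V → Prop} {n : ℕ} {v : ℕ → V}
    (hpath : ∀ i < n, E (v i) (v (i + 1))) {i j : ℕ} (hij : i ≤ j) (hj : j ≤ n) :
    Reach E (v i) (v j) := by
  induction j, hij using Nat.le_induction with
  | base => exact Relation.ReflTransGen.refl
  | succ j _ ih => exact (ih (Nat.le_of_succ_le hj)).tail (hpath j hj)

/-- Case 4 of the paper's Lemma 3.3: if `x` is a descendent of a path
`P = ⟨v 0, …, v ℓ⟩` and `k` is the greatest index with `v k ⪯ x`, then every vertex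
up to index `k` satisfies `v i ⪯ x` and `x ⋠ v i` (so lies in `V_P`), and every
vertex after index `k` is unrelated to `x` (so lies in `V_R`). -/
theorem path_split_descendent {V : Type*} (E : V → V → Prop)
    (ℓ : ℕ) (v : ℕ → V) (hpath : ∀ i < ℓ, E (v i) (v (i + 1)))
    (x : V)
    (hdesc : (∃ i ≤ ℓ, Reach E (v i) x) ∧ ∀ j ≤ ℓ, ¬ Reach E x (v j))
    (k : ℕ)
    (hk : k ≤ ℓ ∧ Reach E (v k) x ∧ ∀ i, k < i → i ≤ ℓ → ¬ Reach E (v i) x) :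
    (∀ i ≤ k, Reach E (v i) x ∧ ¬ Reach E x (v i)) ∧
    (∀ i, k < i → i ≤ ℓ → ¬ Reach E x (v i) ∧ ¬ Reach E (v i) x) ∧
    (∀ i ≤ k, v i ∈ {w : V | Reach E w x ∧ ¬ Reach E x w}) ∧
    (∀ i, k < i → i ≤ ℓ → v i ∈ {w : V | ¬ Reach E x w ∧ ¬ Reach E w x}) := by
  obtain ⟨hkℓ, hkx, hmax⟩ := hk
  have hprefix : ∀ i ≤ k, Reach E (v i) x ∧ ¬ Reach E x (v i) := fun i hi =>
    ⟨(reach_of_path hpath hi hkℓ).trans hkx, hdesc.2 i (hi.trans hkℓ)⟩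
  have hsuffix : ∀ i, k < i → i ≤ ℓ → ¬ Reach E x (v i) ∧ ¬ Reach E (v i) x :=
    fun i hki hi => ⟨hdesc.2 i hi, hmax i hki hi⟩
  exact ⟨hprefix, hsuffix, hprefix, hsuffix⟩
end

section
/- Let G = (V,E) be a finite directed graph, P = ⟨v_0,…,v_ℓ⟩ a path in G, and A the set of ancestors of P. For u ∈ A let a(u) be the least index with u ⪯ v_{a(u)}; let V_S(u) = { w ∈ V : u ⪯ w and w ⋠ u } and V_R(u) = { w ∈ V : u ⋠ w and w ⋠ u }. For u, v ∈ A, say that u preserves v if either (i) v ∈ V_R(u) and, in the induced subgraph G[V_R(u)], v can reach some vertex v_i with i < a(u) but no vertex v_i with i < a(u) can reach v; or (ii) v ∈ V_S(u) and, in the induced subgraph G[V_S(u)], v can reach some vertex v_i with i ≥ a(u) but no vertex v_i with i ≥ a(u) can reach v. Then the preserves relation is irreflexive and antisymmetric on A: no u ∈ A preserves itself, and if u preserves v then v does not preserve u. Consequently, Σ_{u∈A} |{ v ∈ A : u preserves v }| ≤ |A|·(|A|−1)/2. -/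
/-- `ReachIn E U u v`: there is a (possibly empty) directed path from `u` to `v` in the
subgraph induced by the vertex set `U` (all intermediate arcs go between vertices of `U`). -/
def ReachIn {V : Type*} (E : V → V → Prop) (U : Set V) : V → V → Prop :=
  Relation.ReflTransGen (fun a b => a ∈ U ∧ b ∈ U ∧ E a b)

theorem ReachIn.reach {V : Type*} {E : V → V → Prop} {U : Set V} {u v : V}
    (h : ReachIn E U u v) : Reach E u v :=
  Relation.ReflTransGen.mono (fun _ _ h => h.2.2) _ _ h

/-- An irreflexive and antisymmetric relation on a finite set `s` has at most
`|s| (|s| - 1) / 2` related pairs. -/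
theorem Finset.sum_card_filter_le_of_asymm {V : Type*} [DecidableEq V] (s : Finset V)
    (r : V → V → Prop) [DecidableRel r] (hirr : ∀ u ∈ s, ¬ r u u)
    (hasymm : ∀ u ∈ s, ∀ w ∈ s, r u w → ¬ r w u) :
    ∑ u ∈ s, (s.filter (r u)).card ≤ s.card * (s.card - 1) / 2 := by
  have hswap : ∑ u ∈ s, (s.filter (r u)).card = ∑ u ∈ s, (s.filter (r · u)).card :=
    Finset.sum_card_bipartiteAbove_eq_sum_card_bipartiteBelow r
  have hpoint : ∀ u ∈ s, (s.filter (r u)).card + (s.filter (r · u)).card ≤ s.card - 1 := by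
    intro u hu
    have hdisj : Disjoint (s.filter (r u)) (s.filter (r · u)) :=
      Finset.disjoint_filter.2 fun w hw h => hasymm u hu w hw h
    rw [← Finset.card_union_of_disjoint hdisj, ← Finset.card_erase_of_mem hu]
    refine Finset.card_le_card fun w hw => ?_
    have := hirr u hu
    grind
  have hsum := Finset.sum_le_sum hpoint
  rw [Finset.sum_add_distrib, ← hswap, Finset.sum_const, smul_eq_mul] at hsum
  omega

/-- The core of the paper's Lemma 3.4 (asymmetry leads to progress): the `preserves`
relation on the set `A` of ancestors of a path is irreflexive and antisymmetric, and
consequently `Σ_{u∈A} |{ w ∈ A : u preserves w }| ≤ |A|·(|A|−1)/2`. -/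
theorem preserves_antisymmetric {V : Type*} [Fintype V] [DecidableEq V]
    (E : V → V → Prop)
    (ℓ : ℕ) (pv : ℕ → V) (hpath : ∀ i < ℓ, E (pv i) (pv (i + 1)))
    (A : Set V)
    (hA : ∀ u, u ∈ A ↔
      ((∃ i ≤ ℓ, Reach E u (pv i)) ∧ ∀ j ≤ ℓ, ¬ Reach E (pv j) u))
    (a : V → ℕ)
    (ha : ∀ u ∈ A, a u ≤ ℓ ∧ Reach E u (pv (a u)) ∧ ∀ i < a u, ¬ Reach E u (pv i))
    (VS VR : V → Set V)
    (hVS : ∀ u, VS u = {w | Reach E u w ∧ ¬ Reach E w u})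
    (hVR : ∀ u, VR u = {w | ¬ Reach E u w ∧ ¬ Reach E w u})
    (preserves : V → V → Prop)
    (hpres : ∀ u w, preserves u w ↔
      ((w ∈ VR u ∧
          (∃ i < a u, ReachIn E (VR u) w (pv i)) ∧
          ∀ i < a u, ¬ ReachIn E (VR u) (pv i) w) ∨
       (w ∈ VS u ∧
          (∃ i, a u ≤ i ∧ i ≤ ℓ ∧ ReachIn E (VS u) w (pv i)) ∧
          ∀ i, a u ≤ i → i ≤ ℓ → ¬ ReachIn E (VS u) (pv i) w))) :
    (∀ u ∈ A, ¬ preserves u u) ∧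
    (∀ u ∈ A, ∀ w ∈ A, preserves u w → ¬ preserves w u) ∧
    ∑ u ∈ (Set.toFinite A).toFinset, Set.ncard {w ∈ A | preserves u w} ≤
      A.ncard * (A.ncard - 1) / 2 := by
  have hirr : ∀ u ∈ A, ¬ preserves u u := by
    intro u _ h
    have hrefl : Reach E u u := Relation.ReflTransGen.refl
    rcases (hpres u u).1 h with ⟨h, _⟩ | ⟨h, _⟩
    · rw [hVR] at h
      exact h.1 hrefl
    · rw [hVS] at h
      exact h.2 hrefl
  have hlt : ∀ u, ∀ w ∈ A, (∃ i < a u, ReachIn E (VR u) w (pv i)) → a w < a u := by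
    rintro u w hw ⟨i, hi, hr⟩
    by_contra! hle
    exact (ha w hw).2.2 i (hi.trans_le hle) hr.reach
  have hasymm : ∀ u ∈ A, ∀ w ∈ A, preserves u w → ¬ preserves w u := by
    intro u hu w hw huw hwu
    rw [hpres] at huw hwu
    rcases huw with ⟨h, hr, _⟩ | ⟨h, _⟩ <;> rcases hwu with ⟨h', hr', _⟩ | ⟨h', _⟩
    · exact (hlt u w hw hr).asymm (hlt w u hu hr')
    · rw [hVR] at h
      rw [hVS] at h'
      exact h.2 h'.1
    · rw [hVS] at h
      rw [hVR] at h'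
      exact h'.2 h.1
    · rw [hVS] at h h'
      exact h.2 h'.1
  refine ⟨hirr, hasymm, ?_⟩
  classical
  rw [Set.ncard_eq_toFinset_card A (Set.toFinite A)]
  refine le_trans (le_of_eq (Finset.sum_congr rfl fun u _ => ?_))
    (Finset.sum_card_filter_le_of_asymm (Set.toFinite A).toFinset preserves
      (by simpa using hirr) (by simpa using hasymm))
  rw [← Set.ncard_coe_finset]
  congr 1
  ext w
  simp
end

section
/- For all real numbers α, β, δ ≥ 0 with η = α + β + δ > 0, the following inequality holds: (α/η)·√((α/2 + β)(δ + β)) + (δ/η)·√((α + β)(δ/2 + β)) ≤ √((α+β)(δ+β)) / √2. -/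
theorem mul_sqrt_half_add_le {a b c : ℝ} (ha : 0 ≤ a) (hb : 0 ≤ b) (hc : 0 ≤ c) :
    a * Real.sqrt ((a / 2 + b) * c) ≤
      (a + b / 2) * (Real.sqrt ((a + b) * c) / Real.sqrt 2) := by
  rw [← Real.sqrt_div (by positivity)]
  refine abs_le_of_sq_le_sq' ?_ (by positivity) |>.2
  rw [mul_pow, mul_pow, Real.sq_sqrt (by positivity), Real.sq_sqrt (by positivity)]
  have h : 0 ≤ c * (5 * a * b ^ 2 + b ^ 3) / 8 := by positivity
  linarith

/-- The algebraic core of the paper's Lemma 3.8: a random path-related pivot reduces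
the expected value of the potential `φ₁ = √((α+β)(δ+β))` by a factor of at least `√2`. -/
theorem expected_phi1_reduction (α β δ : ℝ)
    (hα : 0 ≤ α) (hβ : 0 ≤ β) (hδ : 0 ≤ δ) (hη : 0 < α + β + δ) :
    (α / (α + β + δ)) * Real.sqrt ((α / 2 + β) * (δ + β)) +
      (δ / (α + β + δ)) * Real.sqrt ((α + β) * (δ / 2 + β))
      ≤ Real.sqrt ((α + β) * (δ + β)) / Real.sqrt 2 := by
  have h₁ := mul_sqrt_half_add_le hα hβ (add_nonneg hδ hβ)
  have h₂ := mul_sqrt_half_add_le hδ hβ (add_nonneg hα hβ)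
  rw [mul_comm (δ / 2 + β), mul_comm (δ + β)] at h₂
  rw [div_mul_eq_mul_div, div_mul_eq_mul_div, ← add_div, div_le_iff₀ hη]
  linarith
end

section
/- For all real numbers α, β, δ ≥ 0 and C > 0 with η = α + β + δ > 0 and δ ≤ α/C, the following inequality holds: (α/η)·(α/2 + β + δ) + δ ≤ η/2 + η/8 + 2η/C. -/
/-- Case 1 computation in the proof of the paper's Lemma 3.10: when `δ ≤ α/C`,
the expected number of remaining path-active vertices after one pivot step is at most
`η/2 + η/8 + 2η/C` where `η = α+β+δ`. -/
theorem case1_imbalance (α β δ C : ℝ)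
    (hα : 0 ≤ α) (hβ : 0 ≤ β) (hδ : 0 ≤ δ) (hC : 0 < C)
    (hη : 0 < α + β + δ) (himb : δ ≤ α / C) :
    (α / (α + β + δ)) * (α / 2 + β + δ) + δ
      ≤ (α + β + δ) / 2 + (α + β + δ) / 8 + 2 * (α + β + δ) / C := by
  have hfrac : α / (α + β + δ) * (α / 2 + β + δ) ≤ 5 / 8 * (α + β + δ) + δ := by
    rw [div_mul_eq_mul_div, div_le_iff₀ hη]
    nlinarith [mul_nonneg hα hβ, mul_nonneg hα hδ, mul_nonneg hβ hδ,
      sq_nonneg α, sq_nonneg β, sq_nonneg δ]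
  have hδη : δ ≤ (α + β + δ) / C :=
    himb.trans (div_le_div_of_nonneg_right (by linarith) hC.le)
  rw [mul_div_assoc 2]
  linarith
end

section
/- For all real numbers p and q with 0 ≤ p ≤ 1 and q ≥ 2/3, the following inequality holds: √p · (p·q − p + 1) ≤ q. -/
/-- The key inequality in the proof of the paper's Lemma 4.10:
`√p · (p·q − p + 1) ≤ q` for `0 ≤ p ≤ 1` and `q ≥ 2/3`. -/
theorem sqrt_p_inequality (p q : ℝ) (hp0 : 0 ≤ p) (hp1 : p ≤ 1) (hq : 2 / 3 ≤ q) :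
    Real.sqrt p * (p * q - p + 1) ≤ q := by
  obtain ⟨s, hs0, hs1, rfl⟩ : ∃ s : ℝ, 0 ≤ s ∧ s ≤ 1 ∧ p = s ^ 2 :=
    ⟨Real.sqrt p, Real.sqrt_nonneg p, Real.sqrt_le_one.mpr hp1, (Real.sq_sqrt hp0).symm⟩
  rw [Real.sqrt_sq hs0]
  have hcube : 0 ≤ 1 - s ^ 3 := sub_nonneg.mpr (pow_le_one₀ hs0 hs1)
  have hfactor : 0 ≤ (s - 1) ^ 2 * (s + 2) := by positivity
  linarith [mul_nonneg (sub_nonneg.mpr hq) hcube]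
end

section
/- Let α, β, δ, ᾱ, β̄, δ̄ be nonnegative real numbers satisfying ᾱ + β̄ ≤ α + β, δ̄ + β̄ ≤ δ + β, β̄ ≤ β, and ᾱ + β̄ + δ̄ ≤ α + β + δ, and suppose η = α + β + δ > 0. Let p = (ᾱ + β̄ + δ̄)/η. Then √((ᾱ+β̄)(δ̄+β̄)) ≤ √p · √((α+β)(δ+β)) and ᾱ + β̄ + δ̄ ≤ √p · η. Consequently, for every C ≥ 0, C·√((ᾱ+β̄)(δ̄+β̄)) + (ᾱ+β̄+δ̄) ≤ √p · ( C·√((α+β)(δ+β)) + η ). -/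
/-- Cross-multiplied monotonicity of `(a + b) * (d + b) / (a + b + d)`. -/
theorem mul_add_mul_sum_le {a b d a' b' d' : ℝ}
    (ha : 0 ≤ a) (hb : 0 ≤ b) (hd : 0 ≤ d)
    (ha' : 0 ≤ a') (hb' : 0 ≤ b') (hd' : 0 ≤ d')
    (h1 : a' + b' ≤ a + b) (h2 : d' + b' ≤ d + b) (h3 : b' ≤ b) :
    (a' + b') * (d' + b') * (a + b + d) ≤ (a' + b' + d') * ((a + b) * (d + b)) := by
  have key : b * (a + b + d) ≤ (a + b) * (d + b) := by
    linarith [mul_nonneg ha hd,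
      show (a + b) * (d + b) = b * (a + b + d) + a * d by ring]
  rcases le_total (a' + b') b with hx | hx
  · calc (a' + b') * (d' + b') * (a + b + d)
        = (d' + b') * ((a' + b') * (a + b + d)) := by ring
      _ ≤ (a' + b' + d') * ((a + b) * (d + b)) := by
        have : (a' + b') * (a + b + d) ≤ (a + b) * (d + b) :=
          (mul_le_mul_of_nonneg_right hx (by positivity)).trans key
        exact mul_le_mul (by linarith) this (by positivity) (by positivity)
  rcases le_total (d' + b') b with hy | hy
  · calc (a' + b') * (d' + b') * (a + b + d)
        = (a' + b') * ((d' + b') * (a + b + d)) := by ring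
      _ ≤ (a' + b' + d') * ((a + b) * (d + b)) := by
        have : (d' + b') * (a + b + d) ≤ (a + b) * (d + b) :=
          (mul_le_mul_of_nonneg_right hy (by positivity)).trans key
        exact mul_le_mul (by linarith) this (by positivity) (by positivity)
  · have e1 : 0 ≤ (a + b) * (a' + b' - b) * (d + b - (d' + b')) :=
      mul_nonneg (mul_nonneg (by positivity) (by linarith)) (by linarith)
    have e2 : 0 ≤ (d' + b') * d * (a + b - (a' + b')) :=
      mul_nonneg (by positivity) (by linarith)
    have e3 : 0 ≤ (a + b) * (d + b) * (b - b') :=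
      mul_nonneg (by positivity) (by linarith)
    linarith

/-- The paper's Lemma 4.11: the potential `φ = C·√((α+β)(δ+β)) + (α+β+δ)` contracts by
at least a factor `√p` when relationships are removed so that the counts `α, β, δ`
become `ᾱ, β̄, δ̄`, where `p` is the surviving fraction of the total. -/
theorem potential_contraction (α β δ abar bbar dbar : ℝ)
    (hα : 0 ≤ α) (hβ : 0 ≤ β) (hδ : 0 ≤ δ)
    (habar : 0 ≤ abar) (hbbar : 0 ≤ bbar) (hdbar : 0 ≤ dbar)
    (h1 : abar + bbar ≤ α + β) (h2 : dbar + bbar ≤ δ + β) (h3 : bbar ≤ β)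
    (h4 : abar + bbar + dbar ≤ α + β + δ)
    (hη : 0 < α + β + δ) :
    Real.sqrt ((abar + bbar) * (dbar + bbar)) ≤
        Real.sqrt ((abar + bbar + dbar) / (α + β + δ)) *
          Real.sqrt ((α + β) * (δ + β)) ∧
    abar + bbar + dbar ≤
        Real.sqrt ((abar + bbar + dbar) / (α + β + δ)) * (α + β + δ) ∧
    ∀ C : ℝ, 0 ≤ C →
      C * Real.sqrt ((abar + bbar) * (dbar + bbar)) + (abar + bbar + dbar) ≤
        Real.sqrt ((abar + bbar + dbar) / (α + β + δ)) *
          (C * Real.sqrt ((α + β) * (δ + β)) + (α + β + δ)) := by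
  have hs : 0 ≤ abar + bbar + dbar := by positivity
  have hp : 0 ≤ (abar + bbar + dbar) / (α + β + δ) := by positivity
  have A : Real.sqrt ((abar + bbar) * (dbar + bbar)) ≤
      Real.sqrt ((abar + bbar + dbar) / (α + β + δ)) * Real.sqrt ((α + β) * (δ + β)) := by
    rw [← Real.sqrt_mul hp]
    apply Real.sqrt_le_sqrt
    rw [div_mul_eq_mul_div, le_div_iff₀ hη]
    exact mul_add_mul_sum_le hα hβ hδ habar hbbar hdbar h1 h2 h3
  have B : abar + bbar + dbar ≤
      Real.sqrt ((abar + bbar + dbar) / (α + β + δ)) * (α + β + δ) := by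
    rw [← div_le_iff₀ hη]
    apply Real.le_sqrt_of_sq_le
    exact pow_le_of_le_one hp ((div_le_one hη).2 h4) two_ne_zero
  refine ⟨A, B, fun C hC => ?_⟩
  linarith [mul_le_mul_of_nonneg_left A hC]
end
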